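/- arXiv:2511.01234 — 7 statements merged into one kernel-verified Lean document; each statement's English description precedes it below -/
import Mathlib

section
/- Let F : ℝ^p × ℝ^q → ℝ be continuously differentiable (C¹). Assume that for each x ∈ ℝ^p the inner problem min_{y ∈ ℝ^q} F(x, y) has a unique solution y*(x), and that the map x ↦ y*(x) is C¹. Define the reduced function F̃(x) = F(x, y*(x)). If x* is a critical point of F̃ (i.e., ∇F̃(x*) = 0), then (x*, y*(x*)) is a critical point of F (i.e., ∇F(x*, y*(x*)) = 0). -/
/-- **Critical Points Preservation (Reduced ⇒ Original).**
If `F : ℝ^p × ℝ^q → ℝ` is C¹, the inner problem `min_y F(x, y)` has a unique solution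
`y*(x)` for every `x`, and `y*` is C¹, then any critical point `x*` of the reduced
function `F̃(x) = F(x, y*(x))` yields a critical point `(x*, y*(x*))` of `F`. -/
theorem critical_points_preservation_reduced_to_original
    {p q : ℕ}
    (F : (Fin p → ℝ) × (Fin q → ℝ) → ℝ)
    (hF : ContDiff ℝ 1 F)
    (ystar : (Fin p → ℝ) → (Fin q → ℝ))
    (hmin : ∀ x y, F (x, ystar x) ≤ F (x, y))
    (huniq : ∀ x y, (∀ y', F (x, y) ≤ F (x, y')) → y = ystar x)
    (hystar : ContDiff ℝ 1 ystar)
    (Ftilde : (Fin p → ℝ) → ℝ)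
    (hFtilde : ∀ x, Ftilde x = F (x, ystar x))
    (xstar : Fin p → ℝ)
    (hcrit : fderiv ℝ Ftilde xstar = 0) :
    fderiv ℝ F (xstar, ystar xstar) = 0 := by
  have hFd : HasFDerivAt F (fderiv ℝ F (xstar, ystar xstar)) (xstar, ystar xstar) :=
    (hF.differentiable one_ne_zero _).hasFDerivAt
  have hyd : HasFDerivAt ystar (fderiv ℝ ystar xstar) xstar :=
    (hystar.differentiable one_ne_zero _).hasFDerivAt
  -- partial derivative in y vanishes, by minimality
  have h2 : HasFDerivAt (fun y => F (xstar, y)) _ (ystar xstar) :=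
    HasFDerivAt.comp (g := F) (f := fun y => (xstar, y)) (ystar xstar) hFd
      ((hasFDerivAt_const xstar (ystar xstar)).prodMk (hasFDerivAt_id (ystar xstar)))
  have hloc : IsLocalMin (fun y => F (xstar, y)) (ystar xstar) :=
    Filter.Eventually.of_forall fun y => hmin xstar y
  have hy0 := hloc.hasFDerivAt_eq_zero h2
  have hy : ∀ v, fderiv ℝ F (xstar, ystar xstar) (0, v) = 0 := fun v => by
    simpa using DFunLike.congr_fun hy0 v
  -- chain rule for the reduced function
  have h1 : HasFDerivAt (fun x => F (x, ystar x)) _ xstar :=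
    HasFDerivAt.comp (g := F) (f := fun x => (x, ystar x)) xstar hFd
      ((hasFDerivAt_id xstar).prodMk hyd)
  have hx0 := h1.fderiv
  rw [← funext hFtilde, hcrit] at hx0
  have hx : ∀ u, fderiv ℝ F (xstar, ystar xstar) (u, fderiv ℝ ystar xstar u) = 0 := fun u => by
    simpa using (DFunLike.congr_fun hx0 u).symm
  refine ContinuousLinearMap.ext fun w => ?_
  obtain ⟨u, v⟩ := w
  have hsplit : ((u, v) : (Fin p → ℝ) × (Fin q → ℝ)) =
      (u, fderiv ℝ ystar xstar u) + (0, v - fderiv ℝ ystar xstar u) := by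
    simp
  rw [hsplit, map_add, hx, hy]
  simp
end

section
/- Let F : ℝ^p × ℝ^q → ℝ be a C² function and assume that for each x ∈ ℝ^p the inner problem min_{y ∈ ℝ^q} F(x, y) has a unique C¹ solution y*(x) with the Hessian ∇²_{yy}F positive definite along (x, y*(x)); define F̃(x) = F(x, y*(x)). If (x₀, y₀) with y₀ = y*(x₀) is a critical point of F whose full Hessian ∇²F(x₀, y₀) is positive definite, then x₀ is a local minimum of the reduced function F̃, and its Hessian ∇²F̃(x₀) is positive definite. -/
open Matrix
open scoped Topology

noncomputable section

variable {p q : ℕ}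

/-- The `i`-th coordinate basis vector of the `x`-block of `ℝ^p × ℝ^q`. -/
def ex (i : Fin p) : (Fin p → ℝ) × (Fin q → ℝ) := (Pi.single i 1, 0)

/-- The `j`-th coordinate basis vector of the `y`-block of `ℝ^p × ℝ^q`. -/
def ey (j : Fin q) : (Fin p → ℝ) × (Fin q → ℝ) := (0, Pi.single j 1)

/-- The block `A = ∇²ₓₓF` of the Hessian of `F` at `z`. -/
def hessXX (F : (Fin p → ℝ) × (Fin q → ℝ) → ℝ) (z : (Fin p → ℝ) × (Fin q → ℝ)) :
    Matrix (Fin p) (Fin p) ℝ :=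
  fun i j => fderiv ℝ (fun w => fderiv ℝ F w (ex j)) z (ex i)

/-- The mixed block `B = ∇²_{yx}F` of the Hessian of `F` at `z`. -/
def hessYX (F : (Fin p → ℝ) × (Fin q → ℝ) → ℝ) (z : (Fin p → ℝ) × (Fin q → ℝ)) :
    Matrix (Fin q) (Fin p) ℝ :=
  fun i j => fderiv ℝ (fun w => fderiv ℝ F w (ex j)) z (ey i)

/-- The block `D = ∇²_{yy}F` of the Hessian of `F` at `z`. -/
def hessYY (F : (Fin p → ℝ) × (Fin q → ℝ) → ℝ) (z : (Fin p → ℝ) × (Fin q → ℝ)) :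
    Matrix (Fin q) (Fin q) ℝ :=
  fun i j => fderiv ℝ (fun w => fderiv ℝ F w (ey j)) z (ey i)

/-- The Hessian matrix of a function `g : ℝ^p → ℝ` at `x`. -/
def hessRed (g : (Fin p → ℝ) → ℝ) (x : Fin p → ℝ) : Matrix (Fin p) (Fin p) ℝ :=
  fun i j => fderiv ℝ (fun z => fderiv ℝ g z (Pi.single j 1)) x (Pi.single i 1)

/-- The full Hessian matrix of `F : ℝ^p × ℝ^q → ℝ` at `z`, indexed by `Fin p ⊕ Fin q`. -/
def fullHess (F : (Fin p → ℝ) × (Fin q → ℝ) → ℝ) (z : (Fin p → ℝ) × (Fin q → ℝ)) :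
    Matrix (Fin p ⊕ Fin q) (Fin p ⊕ Fin q) ℝ :=
  fun a b => fderiv ℝ (fun w => fderiv ℝ F w (Sum.elim ex ey b)) z (Sum.elim ex ey a)

theorem aux_quad {E ι : Type*} [NormedAddCommGroup E] [NormedSpace ℝ E] [Fintype ι]
    (Q : E →L[ℝ] E →L[ℝ] ℝ) (e : ι → E) (M : Matrix ι ι ℝ) (hM : ∀ i j, M i j = Q (e i) (e j))
    (v : ι → ℝ) :
    star v ⬝ᵥ (M *ᵥ v) = Q (∑ i, v i • e i) (∑ i, v i • e i) := by
  simp only [dotProduct, mulVec, hM, map_sum, map_smul, _root_.sum_apply,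
    _root_.smul_apply, Finset.mul_sum, smul_eq_mul, star_trivial]
  rw [Finset.sum_comm]
  refine Finset.sum_congr rfl fun i _ => Finset.sum_congr rfl fun j _ => ?_
  ring

theorem aux_localMin {E : Type*} [NormedAddCommGroup E] [NormedSpace ℝ E] [FiniteDimensional ℝ E]
    (F : E → ℝ) (hF : Differentiable ℝ F) (z : E) (Q : E →L[ℝ] E →L[ℝ] ℝ)
    (hQ : HasFDerivAt (fderiv ℝ F) Q z) (hc : fderiv ℝ F z = 0)
    (hpos : ∀ v, v ≠ 0 → 0 < Q v v) : IsLocalMin F z := by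
  -- coercivity
  obtain ⟨c, hc0, hcoer⟩ : ∃ c : ℝ, 0 < c ∧ ∀ v, c * ‖v‖ ^ 2 ≤ Q v v := by
    by_cases hne : (Metric.sphere (0 : E) 1).Nonempty
    · obtain ⟨u, hu, hmin⟩ := (isCompact_sphere (0 : E) 1).exists_isMinOn hne
        (f := fun v => Q v v) (by fun_prop)
      have hu1 : ‖u‖ = 1 := by simpa using hu
      refine ⟨Q u u, hpos u (by rintro rfl; simp at hu1), fun v => ?_⟩
      by_cases hv : v = 0
      · simp [hv]
      have hn : ‖v‖ ≠ 0 := norm_ne_zero_iff.2 hv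
      have hw : ‖v‖⁻¹ • v ∈ Metric.sphere (0 : E) 1 := by
        simp [norm_smul, hn]
      have h1 : Q u u ≤ Q (‖v‖⁻¹ • v) (‖v‖⁻¹ • v) := hmin hw
      simp only [map_smul, _root_.smul_apply, smul_eq_mul] at h1
      calc Q u u * ‖v‖ ^ 2 ≤ (‖v‖⁻¹ * (‖v‖⁻¹ * Q v v)) * ‖v‖ ^ 2 := by gcongr
        _ = Q v v := by field_simp
    · refine ⟨1, one_pos, fun v => ?_⟩
      have hv : v = 0 := by
        by_contra hv
        exact hne ⟨‖v‖⁻¹ • v, by simp [norm_smul, hv]⟩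
      simp [hv]
  have hlit := hQ.isLittleO.def hc0
  obtain ⟨r, hr, hball⟩ := Metric.eventually_nhds_iff_ball.1 hlit
  refine Metric.eventually_nhds_iff_ball.2 ⟨r, hr, fun w hw => ?_⟩
  set v := w - z with hv
  have hnv : ‖v‖ < r := by simpa [hv, dist_eq_norm] using hw
  have hd : ∀ t : ℝ, HasDerivAt (fun t : ℝ => F (z + t • v)) (fderiv ℝ F (z + t • v) v) t := by
    intro t
    have h1 : HasDerivAt (fun t : ℝ => z + t • v) v t := by
      simpa using ((hasDerivAt_id t).smul_const v).const_add z
    exact (hF _).hasFDerivAt.comp_hasDerivAt t h1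
  have hmono : MonotoneOn (fun t : ℝ => F (z + t • v)) (Set.Icc 0 1) := by
    refine monotoneOn_of_deriv_nonneg (convex_Icc 0 1)
      (fun t _ => (hd t).continuousAt.continuousWithinAt)
      (fun t _ => (hd t).differentiableAt.differentiableWithinAt) fun t ht => ?_
    rw [interior_Icc] at ht
    rw [(hd t).deriv]
    have hmem : z + t • v ∈ Metric.ball z r := by
      simp only [Metric.mem_ball, dist_eq_norm, add_sub_cancel_left, norm_smul, Real.norm_eq_abs,
        abs_of_pos ht.1]
      nlinarith [norm_nonneg v, ht.2]
    have h2 := hball _ hmem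
    rw [hc, sub_zero, add_sub_cancel_left, norm_smul, Real.norm_eq_abs, abs_of_pos ht.1] at h2
    have h3 := (fderiv ℝ F (z + t • v) - Q (t • v)).le_opNorm v
    have h4 : ‖fderiv ℝ F (z + t • v) - Q (t • v)‖ * ‖v‖ ≤ c * (t * ‖v‖) * ‖v‖ := by gcongr
    have h5 := neg_abs_le ((fderiv ℝ F (z + t • v) - Q (t • v)) v)
    rw [← Real.norm_eq_abs] at h5
    have h6 : (fderiv ℝ F (z + t • v) - Q (t • v)) v = fderiv ℝ F (z + t • v) v - t * Q v v := by
      simp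
    have h7 := mul_le_mul_of_nonneg_left (hcoer v) ht.1.le
    rw [h6] at h3 h5
    nlinarith
  have := hmono (Set.left_mem_Icc.2 zero_le_one) (Set.right_mem_Icc.2 zero_le_one) zero_le_one
  simpa [hv] using this

/-- **Preservation of Minima (Original ⇒ Reduced).**
Assume `F` is C², the inner problem has a unique C¹ solution `y*(x)` with
`∇²_{yy}F` positive definite along `(x, y*(x))`.  If `(x₀, y₀)` with `y₀ = y*(x₀)` is a
critical point of `F` whose full Hessian is positive definite, then `x₀` is a local
minimum of the reduced function `F̃(x) = F(x, y*(x))`, with positive definite Hessian. -/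
theorem preservation_of_minima_original_to_reduced
    (F : (Fin p → ℝ) × (Fin q → ℝ) → ℝ)
    (hF : ContDiff ℝ 2 F)
    (ystar : (Fin p → ℝ) → (Fin q → ℝ))
    (hmin : ∀ x y, F (x, ystar x) ≤ F (x, y))
    (huniq : ∀ x y, (∀ y', F (x, y) ≤ F (x, y')) → y = ystar x)
    (hystar : ContDiff ℝ 1 ystar)
    (hDpd : ∀ x, (hessYY F (x, ystar x)).PosDef)
    (x₀ : Fin p → ℝ) (y₀ : Fin q → ℝ) (hy₀ : y₀ = ystar x₀)
    (hcrit : fderiv ℝ F (x₀, y₀) = 0)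
    (hHpd : (fullHess F (x₀, y₀)).PosDef) :
    IsLocalMin (fun x => F (x, ystar x)) x₀ ∧
      (hessRed (fun x => F (x, ystar x)) x₀).PosDef := by
  subst hy₀
  have hF1 : Differentiable ℝ F := hF.differentiable (by norm_num)
  have hdF : ContDiff ℝ 1 (fderiv ℝ F) := hF.fderiv_right (by norm_num)
  have hdF1 : Differentiable ℝ (fderiv ℝ F) := hdF.differentiable (by norm_num)
  have hy1 : Differentiable ℝ ystar := hystar.differentiable (by norm_num)
  set z₀ : (Fin p → ℝ) × (Fin q → ℝ) := (x₀, ystar x₀) with hz₀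
  set Q := fderiv ℝ (fderiv ℝ F) z₀ with hQdef
  have hQ : HasFDerivAt (fderiv ℝ F) Q z₀ := (hdF1 z₀).hasFDerivAt
  have hentry : ∀ a b, fullHess F z₀ a b = Q (Sum.elim ex ey a) (Sum.elim ex ey b) := by
    intro a b
    have h := hQ.clm_apply (hasFDerivAt_const (Sum.elim ex ey b) z₀)
    simp only [fullHess, h.fderiv]
    simp
  have hrepr : ∀ v : (Fin p → ℝ) × (Fin q → ℝ),
      ∑ a, (Sum.elim v.1 v.2 a) • (Sum.elim ex ey a : (Fin p → ℝ) × (Fin q → ℝ)) = v := by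
    intro v
    rw [Fintype.sum_sum_type]
    ext i
    · simp [ex, ey, Prod.fst_sum, Finset.sum_apply, Pi.single_apply]
    · simp [ex, ey, Prod.snd_sum, Finset.sum_apply, Pi.single_apply]
  have hpos : ∀ v, v ≠ 0 → 0 < Q v v := by
    intro v hv
    have hv' : Sum.elim v.1 v.2 ≠ 0 := by
      intro h
      apply hv
      ext i
      · exact congrFun h (Sum.inl i)
      · exact congrFun h (Sum.inr i)
    have h := hHpd.dotProduct_mulVec_pos hv'
    rwa [aux_quad Q _ _ hentry, hrepr] at h
  have hsymm : ∀ u v, Q u v = Q v u := by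
    intro u v
    exact second_derivative_symmetric (fun y => (hF1 y).hasFDerivAt) hQ u v
  have hphi : ∀ x, HasFDerivAt (fun x => (x, ystar x))
      ((ContinuousLinearMap.id ℝ (Fin p → ℝ)).prod (fderiv ℝ ystar x)) x :=
    fun x => (hasFDerivAt_id x).prodMk (hy1 x).hasFDerivAt
  constructor
  · have hl := aux_localMin F hF1 z₀ Q hQ hcrit hpos
    exact hl.comp_continuous (g := fun x => (x, ystar x)) (hphi x₀).continuousAt
  -- first-order condition of the inner problem
  have hgy : ∀ x w, fderiv ℝ F (x, ystar x) (0, w) = 0 := by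
    intro x w
    have h1 : HasFDerivAt (fun y => F (x, y))
        ((fderiv ℝ F (x, ystar x)).comp (ContinuousLinearMap.inr ℝ (Fin p → ℝ) (Fin q → ℝ)))
        (ystar x) :=
      (hF1 (x, ystar x)).hasFDerivAt.comp (ystar x) (hasFDerivAt_prodMk_right x (ystar x))
    have h2 : IsLocalMin (fun y => F (x, y)) (ystar x) :=
      Filter.Eventually.of_forall fun y => hmin x y
    simpa using DFunLike.congr_fun (h2.hasFDerivAt_eq_zero h1) w
  have hg : ∀ x v, fderiv ℝ (fun x => F (x, ystar x)) x v = fderiv ℝ F (x, ystar x) (v, 0) := by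
    intro x v
    have h1 : HasFDerivAt (fun x => F (x, ystar x)) _ x :=
      (hF1 (x, ystar x)).hasFDerivAt.comp x (hphi x)
    rw [h1.fderiv]
    have h2 : (v, fderiv ℝ ystar x v) = (v, 0) + ((0 : Fin p → ℝ), fderiv ℝ ystar x v) := by simp
    simp only [ContinuousLinearMap.comp_apply, ContinuousLinearMap.prod_apply,
      ContinuousLinearMap.id_apply]
    rw [h2, map_add, hgy, add_zero]
  set L := fderiv ℝ ystar x₀ with hL
  have hcomp : ∀ e, HasFDerivAt (fun x => fderiv ℝ F (x, ystar x) e)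
      ((Q.flip e).comp ((ContinuousLinearMap.id ℝ (Fin p → ℝ)).prod L)) x₀ := by
    intro e
    have h1 : HasFDerivAt (fun w => fderiv ℝ F w e) (Q.flip e) z₀ := by
      have h := hQ.clm_apply (hasFDerivAt_const e z₀)
      rw [ContinuousLinearMap.comp_zero, zero_add] at h
      exact h
    exact h1.comp x₀ (hphi x₀)
  have hQy : ∀ u w, Q (u, L u) (0, w) = 0 := by
    intro u w
    have h1 := hcomp (0, w)
    simp only [hgy] at h1
    have h2 := DFunLike.congr_fun (h1.unique (hasFDerivAt_const (0 : ℝ) x₀)) u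
    simpa using h2
  set P := (ContinuousLinearMap.id ℝ (Fin p → ℝ)).prod L with hP
  let R : (Fin p → ℝ) →L[ℝ] (Fin p → ℝ) →L[ℝ] ℝ := Q.bilinearComp P P
  have hR : ∀ u v, R u v = Q (u, L u) (v, L v) := fun u v => rfl
  have hent : ∀ i j, hessRed (fun x => F (x, ystar x)) x₀ i j =
      R (Pi.single i 1) (Pi.single j 1) := by
    intro i j
    simp only [hessRed, hg]
    rw [(hcomp _).fderiv, hR]
    have h2 : ((Pi.single j 1 : Fin p → ℝ), L (Pi.single j 1)) =
      (Pi.single j 1, 0) + ((0 : Fin p → ℝ), L (Pi.single j 1)) := by simp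
    rw [h2, map_add, hQy, add_zero]
    rfl
  refine Matrix.PosDef.of_dotProduct_mulVec_pos ?_ fun v hv => ?_
  · ext i j
    simp only [conjTranspose_apply, star_trivial, hent, hR]
    exact hsymm _ _
  · rw [aux_quad R _ _ hent]
    have hs : ∑ i, v i • (Pi.single i 1 : Fin p → ℝ) = v := by
      ext k
      simp [Finset.sum_apply, Pi.single_apply]
    rw [hs, hR]
    exact hpos _ fun h => hv (congrArg Prod.fst h)


end
end

section
/- Let F : ℝ^p × ℝ^q → ℝ be a C² function and assume that for each x ∈ ℝ^p the inner problem min_{y ∈ ℝ^q} F(x, y) has a unique C¹ solution y*(x) with the Hessian ∇²_{yy}F positive definite along (x, y*(x)); define F̃(x) = F(x, y*(x)). If x₀ is a critical point of F̃ whose Hessian ∇²F̃(x₀) is positive definite, then (x₀, y*(x₀)) is a local minimum of F, and the full Hessian ∇²F(x₀, y*(x₀)) is positive definite. -/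
open Matrix
open scoped Topology

noncomputable section

variable {p q : ℕ}

lemma quad_eq {n E : Type*} [Fintype n] [NormedAddCommGroup E] [NormedSpace ℝ E]
    (H : E →L[ℝ] E →L[ℝ] ℝ) (e : n → E) (c : n → ℝ) (M : Matrix n n ℝ)
    (hM : ∀ i j, M i j = H (e i) (e j)) :
    star c ⬝ᵥ (M *ᵥ c) = H (∑ i, c i • e i) (∑ i, c i • e i) := by
  simp only [dotProduct, mulVec, hM, map_sum, map_smul, _root_.sum_apply,
    _root_.smul_apply, smul_eq_mul, Pi.star_apply, star_trivial, Finset.mul_sum]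
  rw [Finset.sum_comm]
  refine Finset.sum_congr rfl fun i _ => Finset.sum_congr rfl fun j _ => ?_
  ring

lemma coercive_of_pos {E : Type*} [NormedAddCommGroup E] [NormedSpace ℝ E]
    [FiniteDimensional ℝ E] (K : E →L[ℝ] E →L[ℝ] ℝ) (hpos : ∀ v, v ≠ 0 → 0 < K v v) :
    ∃ c > 0, ∀ v, c * ‖v‖ ^ 2 ≤ K v v := by
  have hc : IsCompact (Metric.sphere (0 : E) 1) := isCompact_sphere 0 1
  rcases (Metric.sphere (0 : E) 1).eq_empty_or_nonempty with h | h
  · refine ⟨1, one_pos, fun v => ?_⟩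
    by_cases hv : v = 0
    · simp [hv]
    · exfalso
      have : (‖v‖⁻¹ • v) ∈ Metric.sphere (0 : E) 1 := by
        simp [norm_smul, hv]
      rw [h] at this
      exact this
  · obtain ⟨u, hu, hmin⟩ := hc.exists_isMinOn h
      (f := fun v => K v v) (by fun_prop)
    have hu0 : u ≠ 0 := by
      rintro rfl
      simp at hu
    refine ⟨K u u, hpos u hu0, fun v => ?_⟩
    by_cases hv : v = 0
    · simp [hv]
    · have hm : (‖v‖⁻¹ • v) ∈ Metric.sphere (0 : E) 1 := by
        simp [norm_smul, hv]
      have h1 : K u u ≤ K (‖v‖⁻¹ • v) (‖v‖⁻¹ • v) := hmin hm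
      simp only [map_smul, _root_.smul_apply, smul_eq_mul] at h1
      have hn : 0 < ‖v‖ := norm_pos_iff.mpr hv
      calc K u u * ‖v‖ ^ 2 ≤ (‖v‖⁻¹ * (‖v‖⁻¹ * K v v)) * ‖v‖ ^ 2 := by gcongr
        _ = K v v := by field_simp

lemma isLocalMin_of_second {E : Type*} [NormedAddCommGroup E] [NormedSpace ℝ E]
    [FiniteDimensional ℝ E] (g : E → ℝ) (g' : E → E →L[ℝ] ℝ) (x₀ : E)
    (hg : ∀ x, HasFDerivAt g (g' x) x) (K : E →L[ℝ] E →L[ℝ] ℝ)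
    (hK : HasFDerivAt g' K x₀) (h0 : g' x₀ = 0) (hpos : ∀ v, v ≠ 0 → 0 < K v v) :
    IsLocalMin g x₀ := by
  obtain ⟨c, hc, hco⟩ := coercive_of_pos K hpos
  have hev := hK.isLittleO.bound hc
  obtain ⟨δ, hδ, hball⟩ := Metric.eventually_nhds_iff_ball.mp hev
  refine Metric.eventually_nhds_iff_ball.mpr ⟨δ, hδ, fun x hx => ?_⟩
  set h := x - x₀ with hh
  have hhδ : ‖h‖ < δ := by rwa [mem_ball_iff_norm] at hx
  have hd : ∀ t : ℝ, HasDerivAt (fun t : ℝ => g (x₀ + t • h)) (g' (x₀ + t • h) h) t := by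
    intro t
    have h1 : HasDerivAt (fun t : ℝ => x₀ + t • h) h t := by
      simpa using ((hasDerivAt_id t).smul_const h).const_add x₀
    exact (hg _).comp_hasDerivAt t h1
  have hmono : MonotoneOn (fun t : ℝ => g (x₀ + t • h)) (Set.Icc 0 1) := by
    refine monotoneOn_of_deriv_nonneg (convex_Icc 0 1)
      (fun t _ => (hd t).continuousAt.continuousWithinAt)
      (fun t _ => (hd t).differentiableAt.differentiableWithinAt) ?_
    intro t ht
    rw [interior_Icc] at ht
    rw [(hd t).deriv]
    have hin : x₀ + t • h ∈ Metric.ball x₀ δ := by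
      rw [mem_ball_iff_norm, add_sub_cancel_left, norm_smul, Real.norm_of_nonneg ht.1.le]
      nlinarith [norm_nonneg h, ht.2]
    have hb := hball _ hin
    rw [h0, sub_zero, add_sub_cancel_left, norm_smul, Real.norm_of_nonneg ht.1.le] at hb
    have h2 : ‖(g' (x₀ + t • h) - K (t • h)) h‖ ≤ c * (t * ‖h‖) * ‖h‖ :=
      ContinuousLinearMap.le_of_opNorm_le _ hb h
    rw [Real.norm_eq_abs] at h2
    have h3 := (abs_le.mp h2).1
    simp only [_root_.sub_apply, map_smul, _root_.smul_apply,
      smul_eq_mul] at h3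
    nlinarith [mul_le_mul_of_nonneg_left (hco h) ht.1.le]
  have := hmono (Set.left_mem_Icc.mpr zero_le_one) (Set.right_mem_Icc.mpr zero_le_one) zero_le_one
  simpa [hh] using this

lemma sum_ex (c : Fin p → ℝ) :
    ∑ i, c i • (Pi.single i 1 : Fin p → ℝ) = c := by
  ext k
  simp [Finset.sum_apply, Pi.single_apply]

lemma fderiv_apply_const {E : Type*} [NormedAddCommGroup E] [NormedSpace ℝ E]
    {G : E → E →L[ℝ] ℝ} {K : E →L[ℝ] E →L[ℝ] ℝ} {z : E} (hG : HasFDerivAt G K z) (u v : E) :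
    fderiv ℝ (fun w => G w v) z u = K u v := by
  have := hG.clm_apply (hasFDerivAt_const v z)
  rw [this.fderiv]
  simp

/-- **Preservation of Minima (Reduced ⇒ Original).**
Assume `F` is C², the inner problem has a unique C¹ solution `y*(x)` with
`∇²_{yy}F` positive definite along `(x, y*(x))`.  If `x₀` is a critical point of the
reduced function `F̃(x) = F(x, y*(x))` whose Hessian is positive definite, then
`(x₀, y*(x₀))` is a local minimum of `F` with positive definite full Hessian. -/
theorem preservation_of_minima_reduced_to_original
    (F : (Fin p → ℝ) × (Fin q → ℝ) → ℝ)
    (hF : ContDiff ℝ 2 F)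
    (ystar : (Fin p → ℝ) → (Fin q → ℝ))
    (hmin : ∀ x y, F (x, ystar x) ≤ F (x, y))
    (huniq : ∀ x y, (∀ y', F (x, y) ≤ F (x, y')) → y = ystar x)
    (hystar : ContDiff ℝ 1 ystar)
    (hDpd : ∀ x, (hessYY F (x, ystar x)).PosDef)
    (x₀ : Fin p → ℝ)
    (hcrit : fderiv ℝ (fun x => F (x, ystar x)) x₀ = 0)
    (hRedPd : (hessRed (fun x => F (x, ystar x)) x₀).PosDef) :
    IsLocalMin F (x₀, ystar x₀) ∧ (fullHess F (x₀, ystar x₀)).PosDef := by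
  have hFd : ∀ z, HasFDerivAt F (fderiv ℝ F z) z := fun z =>
    (hF.differentiable (by norm_num) z).hasFDerivAt
  have hyd : ∀ x, HasFDerivAt ystar (fderiv ℝ ystar x) x := fun x =>
    (hystar.differentiable (by norm_num) x).hasFDerivAt
  have hF' : ContDiff ℝ 1 (fderiv ℝ F) := hF.fderiv_right (by norm_num)
  set z₀ := (x₀, ystar x₀) with hz₀
  set H := fderiv ℝ (fderiv ℝ F) z₀ with hH
  set L := fderiv ℝ ystar x₀ with hL
  have hHd : HasFDerivAt (fderiv ℝ F) H z₀ :=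
    (hF'.differentiable (by norm_num) z₀).hasFDerivAt
  have hsymm : ∀ u v, H u v = H v u := fun u v =>
    (hF.contDiffAt.isSymmSndFDerivAt (by simp)) u v
  -- the partial derivative in `y` vanishes along the graph
  have hy0 : ∀ x w, fderiv ℝ F (x, ystar x) (0, w) = 0 := by
    intro x w
    have h1 : IsLocalMin (fun y => F (x, y)) (ystar x) :=
      Filter.Eventually.of_forall fun y => hmin x y
    have h2 : HasFDerivAt (fun y => F (x, y))
        ((fderiv ℝ F (x, ystar x)).comp (ContinuousLinearMap.inr ℝ _ _)) (ystar x) :=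
      (hFd (x, ystar x)).comp (ystar x) (hasFDerivAt_prodMk_right x (ystar x))
    have h3 := h1.hasFDerivAt_eq_zero h2
    simpa using congrArg (fun T => T w) h3
  have hgr : ∀ x, HasFDerivAt (fun x => (x, ystar x))
      ((ContinuousLinearMap.id ℝ _).prod (fderiv ℝ ystar x)) x := fun x =>
    (hasFDerivAt_id x).prodMk (hyd x)
  set g' : (Fin p → ℝ) → (Fin p → ℝ) →L[ℝ] ℝ :=
    fun x => (fderiv ℝ F (x, ystar x)).comp (ContinuousLinearMap.inl ℝ _ _) with hg'
  have hg : ∀ x, HasFDerivAt (fun x => F (x, ystar x)) (g' x) x := by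
    intro x
    have h1 : HasFDerivAt (fun x => F (x, ystar x)) _ x :=
      (hFd (x, ystar x)).comp x (hgr x)
    refine h1.congr_fderiv ?_
    refine ContinuousLinearMap.ext fun v => ?_
    have h2 : (v, fderiv ℝ ystar x v) = (v, 0) + (0, fderiv ℝ ystar x v) := by simp
    simp only [hg', ContinuousLinearMap.comp_apply, ContinuousLinearMap.inl_apply,
      ContinuousLinearMap.prod_apply, ContinuousLinearMap.id_apply]
    rw [h2, map_add, hy0, add_zero]
  have hcomp : HasFDerivAt (fun x => fderiv ℝ F (x, ystar x))
      (H.comp ((ContinuousLinearMap.id ℝ _).prod L)) x₀ := hHd.comp x₀ (hgr x₀)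
  have hmix : ∀ u w, H (u, L u) (0, w) = 0 := by
    intro u w
    have h1 := hcomp.clm_apply (hasFDerivAt_const ((0, w) : (Fin p → ℝ) × (Fin q → ℝ)) x₀)
    simp only [hy0] at h1
    have h2 := congrArg (fun T => T u) (h1.unique (hasFDerivAt_const 0 x₀))
    simpa using h2
  obtain ⟨K, hK, hKapp⟩ : ∃ K : (Fin p → ℝ) →L[ℝ] (Fin p → ℝ) →L[ℝ] ℝ,
      HasFDerivAt g' K x₀ ∧ ∀ u v, K u v = H (u, L u) (v, 0) := by
    refine ⟨_, hcomp.clm_comp (hasFDerivAt_const (ContinuousLinearMap.inl ℝ _ _) x₀), ?_⟩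
    intro u v
    simp
  have hfg : fderiv ℝ (fun x => F (x, ystar x)) = g' := funext fun x => (hg x).fderiv
  have hKpos : ∀ v, v ≠ 0 → 0 < K v v := by
    intro v hv
    have h1 := hRedPd.dotProduct_mulVec_pos hv
    rw [quad_eq K (fun i => Pi.single i 1) v _ (fun i j => ?_), sum_ex] at h1
    · exact h1
    · simp only [hessRed, hfg]
      exact fderiv_apply_const hK _ _
  have hDpos : ∀ w, w ≠ 0 → 0 < H (0, w) (0, w) := by
    intro w hw
    have h1 := (hDpd x₀).dotProduct_mulVec_pos hw
    rw [quad_eq H ey w (hessYY F (x₀, ystar x₀)) (fun i j => fderiv_apply_const hHd _ _)] at h1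
    have h2 : ∑ i, w i • (ey i : (Fin p → ℝ) × (Fin q → ℝ)) = (0, w) := by
      refine Prod.ext ?_ ?_
      · simp [ey, Prod.fst_sum]
      · simpa [ey, Prod.snd_sum] using sum_ex w
    rwa [h2] at h1
  have hHpos : ∀ u w, (u ≠ 0 ∨ w ≠ 0) → 0 < H (u, w) (u, w) := by
    intro u w huw
    have h1 : ((u, w) : (Fin p → ℝ) × (Fin q → ℝ)) = (u, L u) + (0, w - L u) := by simp
    have h2 : ((u, L u) : (Fin p → ℝ) × (Fin q → ℝ)) = (u, 0) + (0, L u) := by simp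
    have h3 : H (u, L u) (u, L u) = K u u := by
      rw [hKapp]
      conv_lhs => rw [show H (u, L u) (u, L u) = H (u, L u) ((u, 0) + (0, L u)) by rw [← h2]]
      rw [map_add, hmix, add_zero]
    have h4 : H (u, w) (u, w) = K u u + H (0, w - L u) (0, w - L u) := by
      rw [h1]
      simp only [map_add, _root_.add_apply]
      rw [hsymm (0, w - L u) (u, L u), hmix, h3]
      ring
    rw [h4]
    by_cases hu : u = 0
    · have hw : w ≠ 0 := by tauto
      subst hu
      simpa using hDpos w hw
    · by_cases hw : w - L u = 0
      · have h5 : H (0, w - L u) (0, w - L u) = 0 := by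
          rw [hw, ← Prod.zero_eq_mk, map_zero]
        rw [h5, add_zero]
        exact hKpos u hu
      · exact add_pos (hKpos u hu) (hDpos _ hw)
  refine ⟨?_, ?_⟩
  · have hlm : IsLocalMin (fun x => F (x, ystar x)) x₀ :=
      isLocalMin_of_second _ g' x₀ hg K hK (by rw [← hfg, hcrit]) hKpos
    have ht : Filter.Tendsto Prod.fst (𝓝 z₀) (𝓝 x₀) := continuous_fst.tendsto z₀
    filter_upwards [ht.eventually hlm] with z hz
    exact hz.trans (hmin z.1 z.2)
  · have hent : ∀ a b, fullHess F z₀ a b = H (Sum.elim ex ey a) (Sum.elim ex ey b) :=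
      fun a b => fderiv_apply_const hHd _ _
    refine .of_dotProduct_mulVec_pos ?_ ?_
    · ext a b
      rw [conjTranspose_apply, star_trivial, hent, hent, hsymm]
    · intro c hc
      rw [quad_eq H (Sum.elim ex ey) c _ hent]
      have h2 : ∑ a, c a • (Sum.elim ex ey a : (Fin p → ℝ) × (Fin q → ℝ))
          = (c ∘ Sum.inl, c ∘ Sum.inr) := by
        rw [Fintype.sum_sum_type]
        refine Prod.ext ?_ ?_
        · simpa [ex, ey, Prod.fst_sum] using sum_ex (c ∘ Sum.inl)
        · simpa [ex, ey, Prod.snd_sum] using sum_ex (c ∘ Sum.inr)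
      rw [h2]
      apply hHpos
      by_contra! hcon
      apply hc
      ext a
      rcases a with a | a
      · exact congrFun hcon.1 a
      · exact congrFun hcon.2 a

end
end

section
/- Let H be a real symmetric (p+q)×(p+q) matrix written in block form H = [[A, Bᵀ],[B, D]] with A a symmetric p×p matrix, D a symmetric q×q matrix, and B a q×p matrix. If D is positive definite, then the number of negative eigenvalues of H (counted with multiplicity) equals the number of negative eigenvalues of the Schur complement S = A − BᵀD⁻¹B, the number of zero eigenvalues of H equals the number of zero eigenvalues of S, and the number of positive eigenvalues of H equals q plus the number of positive eigenvalues of S. -/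
open Matrix

/-- Congruent diagonal matrices define equivalent weighted sums of squares. -/
lemma weightedSumSquares_equivalent_of_congr {ι : Type*} [Fintype ι] [DecidableEq ι]
    (w v : ι → ℝ) (P Q : Matrix ι ι ℝ) (hPQ : P * Q = 1)
    (h : diagonal w = Pᵀ * diagonal v * P) :
    QuadraticMap.Equivalent (QuadraticMap.weightedSumSquares ℝ w)
      (QuadraticMap.weightedSumSquares ℝ v) := by
  have hQP : Q * P = 1 := mul_eq_one_comm.mp hPQ
  have key : ∀ (u x : ι → ℝ), QuadraticMap.weightedSumSquares ℝ u x
      = x ⬝ᵥ (diagonal u *ᵥ x) := by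
    intro u x
    simp [QuadraticMap.weightedSumSquares_apply, dotProduct, mulVec_diagonal]
    exact Finset.sum_congr rfl fun i _ => by ring
  refine ⟨⟨LinearEquiv.ofLinearMap (toLin' P) (toLin' Q) ?_ ?_, ?_⟩⟩
  · rw [← toLin'_mul, hPQ, toLin'_one]
  · rw [← toLin'_mul, hQP, toLin'_one]
  · intro x
    change QuadraticMap.weightedSumSquares ℝ v (toLin' P x) = _
    rw [key, key, h, toLin'_apply, ← mulVec_mulVec, ← mulVec_mulVec, dotProduct_mulVec x Pᵀ,
      vecMul_transpose]

/-- Real spectral theorem with explicit orthogonal matrix. -/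
lemma exists_orthogonal_diag {ι : Type*} [Fintype ι] [DecidableEq ι]
    {M : Matrix ι ι ℝ} (hM : M.IsHermitian) :
    ∃ U : Matrix ι ι ℝ, U * Uᵀ = 1 ∧ Uᵀ * U = 1 ∧ M = U * diagonal hM.eigenvalues * Uᵀ := by
  have h1 : (hM.eigenvectorUnitary : Matrix ι ι ℝ) * (hM.eigenvectorUnitary : Matrix ι ι ℝ)ᵀ = 1 := by
    have := Unitary.coe_mul_star_self hM.eigenvectorUnitary
    rwa [Unitary.coe_star, star_eq_conjTranspose, conjTranspose_eq_transpose_of_trivial] at this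
  refine ⟨hM.eigenvectorUnitary, h1, mul_eq_one_comm.mp h1, ?_⟩
  have := hM.spectral_theorem
  rw [Unitary.conjStarAlgAut_apply, star_eq_conjTranspose,
    conjTranspose_eq_transpose_of_trivial] at this
  exact this



/-- **Haynsworth inertia additivity formula (with `D` positive definite).**
Let `H = [[A, Bᵀ], [B, D]]` be a real symmetric `(p+q)×(p+q)` matrix with `D` positive
definite, and let `S = A − Bᵀ D⁻¹ B` be the Schur complement of `D`.  Then `H` and `S`
have the same number of negative eigenvalues, the same number of zero eigenvalues,
and `H` has exactly `q` more positive eigenvalues than `S`: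
`In(H) = (q, 0, 0) + In(S)`. -/
theorem haynsworth_inertia_additivity_posdef_block
    {p q : ℕ}
    (A : Matrix (Fin p) (Fin p) ℝ) (B : Matrix (Fin q) (Fin p) ℝ)
    (D : Matrix (Fin q) (Fin q) ℝ)
    (hA : A.IsHermitian) (hD : D.IsHermitian) (hDpd : D.PosDef)
    (H : Matrix (Fin p ⊕ Fin q) (Fin p ⊕ Fin q) ℝ)
    (hHdef : H = Matrix.fromBlocks A Bᵀ B D)
    (hH : H.IsHermitian)
    (S : Matrix (Fin p) (Fin p) ℝ)
    (hSdef : S = A - Bᵀ * D⁻¹ * B)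
    (hS : S.IsHermitian) :
    Fintype.card {i // hH.eigenvalues i < 0} = Fintype.card {i // hS.eigenvalues i < 0} ∧
    Fintype.card {i // hH.eigenvalues i = 0} = Fintype.card {i // hS.eigenvalues i = 0} ∧
    Fintype.card {i // 0 < hH.eigenvalues i} = q + Fintype.card {i // 0 < hS.eigenvalues i} := by
  classical
  obtain ⟨U, hU1, hU2, hU⟩ := exists_orthogonal_diag hH
  obtain ⟨V, hV1, hV2, hV⟩ := exists_orthogonal_diag hS
  obtain ⟨W, hW1, hW2, hW⟩ := exists_orthogonal_diag hD
  have hDpos : ∀ i, 0 < hD.eigenvalues i := fun i => hDpd.eigenvalues_pos i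
  have hdet : IsUnit D.det := hDpd.det_pos.ne'.isUnit
  have hDi : D * D⁻¹ = 1 := mul_nonsing_inv _ hdet
  have hDi' : D⁻¹ * D = 1 := nonsing_inv_mul _ hdet
  have hDt : Dᵀ = D := by simpa [IsHermitian] using hD
  have hDit : (D⁻¹)ᵀ = D⁻¹ := by rw [transpose_nonsing_inv, hDt]
  set L : Matrix (Fin p ⊕ Fin q) (Fin p ⊕ Fin q) ℝ := fromBlocks 1 0 (D⁻¹ * B) 1 with hL
  set L' : Matrix (Fin p ⊕ Fin q) (Fin p ⊕ Fin q) ℝ := fromBlocks 1 0 (-(D⁻¹ * B)) 1 with hL'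
  have hLL : L * L' = 1 := by
    simp [hL, hL', fromBlocks_multiply]
  set Z : Matrix (Fin p ⊕ Fin q) (Fin p ⊕ Fin q) ℝ := fromBlocks V 0 0 W with hZ
  have hZt : Zᵀ = fromBlocks Vᵀ 0 0 Wᵀ := by simp [hZ, fromBlocks_transpose]
  have hZZ : Zᵀ * Z = 1 := by
    rw [hZt, hZ, fromBlocks_multiply]
    simp [hV2, hW2]
  set d : Fin p ⊕ Fin q → ℝ := Sum.elim hS.eigenvalues hD.eigenvalues with hd
  have hblk : fromBlocks S 0 0 D = Z * diagonal d * Zᵀ := by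
    rw [hZt, hZ, hd, ← fromBlocks_diagonal, fromBlocks_multiply, fromBlocks_multiply]
    simp [← hV, ← hW]
  have hHL : H = Lᵀ * fromBlocks S 0 0 D * L := by
    rw [hHdef, hL, fromBlocks_transpose, fromBlocks_multiply, fromBlocks_multiply]
    simp [hSdef, transpose_mul, hDit, Matrix.mul_assoc, hDi']
    simp [← Matrix.mul_assoc, hDi]
  have hcongr : diagonal hH.eigenvalues = (Zᵀ * L * U)ᵀ * diagonal d * (Zᵀ * L * U) := by
    have e1 : diagonal hH.eigenvalues = Uᵀ * H * U := by
      have : Uᵀ * (U * diagonal hH.eigenvalues * Uᵀ) * U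
          = (Uᵀ * U) * diagonal hH.eigenvalues * (Uᵀ * U) := by
        simp only [Matrix.mul_assoc]
      rw [← hU, hU2] at this
      simpa using this.symm
    rw [e1, hHL, hblk]
    simp only [transpose_mul, transpose_transpose, Matrix.mul_assoc]
  have hinv : (Zᵀ * L * U) * (Uᵀ * L' * Z) = 1 := by
    calc (Zᵀ * L * U) * (Uᵀ * L' * Z) = Zᵀ * (L * ((U * Uᵀ) * L')) * Z := by
          simp only [Matrix.mul_assoc]
      _ = 1 := by rw [hU1, Matrix.one_mul, hLL, Matrix.mul_one, hZZ]
  have heq := weightedSumSquares_equivalent_of_congr _ _ _ _ hinv hcongr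
  have hp := QuadraticForm.sigPos_of_equiv_weightedSumSquares heq
  have hn := QuadraticForm.sigNeg_of_equiv_weightedSumSquares heq
  rw [QuadraticForm.sigPos_weightedSumSquares] at hp
  rw [QuadraticForm.sigNeg_weightedSumSquares] at hn
  have conv : ∀ {ι : Type} [Fintype ι] (P : ι → Prop) [DecidablePred P],
      {i | P i}.ncard = Fintype.card {i // P i} := by
    intro ι _ P _
    rw [← Nat.card_eq_fintype_card]
    rfl
  have tri : ∀ {ι : Type} [Fintype ι] (w : ι → ℝ), Fintype.card {i // w i < 0} +
      Fintype.card {i // w i = 0} + Fintype.card {i // 0 < w i} = Fintype.card ι := by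
    intro ι _ w
    simp only [Fintype.card_subtype, Finset.card_filter, ← Finset.sum_add_distrib]
    rw [Fintype.card_eq_sum_ones]
    refine Finset.sum_congr rfl fun i _ => ?_
    rcases lt_trichotomy (w i) 0 with h | h | h
    · simp [h, h.ne, h.le]
    · simp [h]
    · simp [h, h.ne', h.le]
  rw [conv, conv] at hp hn
  have hp' : Fintype.card {i // 0 < d i} = q + Fintype.card {i // 0 < hS.eigenvalues i} := by
    simp only [Fintype.card_subtype, Finset.card_filter, Fintype.sum_sum_type, hd, Sum.elim_inl,
      Sum.elim_inr, hDpos]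
    simp [add_comm]
    rw [Finset.card_filter]
    congr!
  have hn' : Fintype.card {i // d i < 0} = Fintype.card {i // hS.eigenvalues i < 0} := by
    simp only [Fintype.card_subtype, Finset.card_filter, Fintype.sum_sum_type, hd, Sum.elim_inl,
      Sum.elim_inr, (hDpos _).not_gt]
    simp
    rw [Finset.card_filter]
    congr!
  have t1 := tri hH.eigenvalues
  have t2 := tri hS.eigenvalues
  simp only [Fintype.card_sum, Fintype.card_fin] at t1 t2
  have g1 := hn.trans hn'
  have g3 := hp.trans hp'
  refine ⟨by convert g1, ?_, by convert g3⟩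
  have g2 : _ := t1.trans (by rw [← t2])
  convert_to Fintype.card {i // hH.eigenvalues i = 0} = Fintype.card {i // hS.eigenvalues i = 0}
  omega
end

section
/- Let F : ℝ^p × ℝ^q → ℝ and let y* : ℝ^p → ℝ^q satisfy F(x, y*(x)) ≤ F(x, y) for all x ∈ ℝ^p and y ∈ ℝ^q; define F̃(x) = F(x, y*(x)). If (x₀, y₀) with y₀ = y*(x₀) is a local minimum of F on ℝ^p × ℝ^q, and y* is continuous at x₀, then x₀ is a local minimum of the reduced function F̃. No positive definiteness or second-order assumptions are required. -/
/-- **Local minima of the original problem restrict to the reduced problem.**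
Let `y* : ℝ^p → ℝ^q` pointwise minimize `y ↦ F(x, y)`.  If `(x₀, y₀)` with
`y₀ = y*(x₀)` is a local minimum of `F` on `ℝ^p × ℝ^q` and `y*` is continuous at
`x₀`, then `x₀` is a local minimum of the reduced function `F̃(x) = F(x, y*(x))`. -/
theorem local_min_original_to_reduced
    {p q : ℕ}
    (F : (Fin p → ℝ) × (Fin q → ℝ) → ℝ)
    (ystar : (Fin p → ℝ) → (Fin q → ℝ))
    (hmin : ∀ x y, F (x, ystar x) ≤ F (x, y))
    (Ftilde : (Fin p → ℝ) → ℝ)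
    (hFtilde : ∀ x, Ftilde x = F (x, ystar x))
    (x₀ : Fin p → ℝ) (y₀ : Fin q → ℝ) (hy₀ : y₀ = ystar x₀)
    (hloc : IsLocalMin F (x₀, y₀))
    (hcont : ContinuousAt ystar x₀) :
    IsLocalMin Ftilde x₀ := by
  subst hy₀
  have ht : Filter.Tendsto (fun x => (x, ystar x)) (nhds x₀) (nhds (x₀, ystar x₀)) :=
    continuousAt_id.prodMk hcont
  have h := ht.eventually hloc
  filter_upwards [h] with x hx
  rw [hFtilde, hFtilde]
  exact hx
end

section
/- Let F : ℝ^p × ℝ^q → ℝ and let y* : ℝ^p → ℝ^q satisfy F(x, y*(x)) ≤ F(x, y) for all x ∈ ℝ^p and y ∈ ℝ^q; define F̃(x) = F(x, y*(x)). If x₀ is a local minimum of the reduced function F̃, then (x₀, y*(x₀)) is a local minimum of F on ℝ^p × ℝ^q: there is a neighborhood N of (x₀, y*(x₀)) such that F(x₀, y*(x₀)) ≤ F(x, y) for all (x, y) ∈ N. No positive definiteness or second-order assumptions are required. -/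
/-- **Local minima of the reduced problem lift to the original problem.**
Let `y* : ℝ^p → ℝ^q` pointwise minimize `y ↦ F(x, y)`.  If `x₀` is a local minimum
of the reduced function `F̃(x) = F(x, y*(x))`, then `(x₀, y*(x₀))` is a local minimum
of `F` on `ℝ^p × ℝ^q`: there is a neighborhood `N` of `(x₀, y*(x₀))` on which
`F(x₀, y*(x₀)) ≤ F(x, y)`. -/
theorem local_min_reduced_to_original
    {p q : ℕ}
    (F : (Fin p → ℝ) × (Fin q → ℝ) → ℝ)
    (ystar : (Fin p → ℝ) → (Fin q → ℝ))
    (hmin : ∀ x y, F (x, ystar x) ≤ F (x, y))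
    (Ftilde : (Fin p → ℝ) → ℝ)
    (hFtilde : ∀ x, Ftilde x = F (x, ystar x))
    (x₀ : Fin p → ℝ)
    (hloc : IsLocalMin Ftilde x₀) :
    IsLocalMin F (x₀, ystar x₀) := by
  have h : ∀ᶠ z in nhds (x₀, ystar x₀), Ftilde x₀ ≤ Ftilde z.1 :=
    (continuous_fst.tendsto (x₀, ystar x₀)).eventually hloc
  refine Filter.Eventually.mono h ?_
  rintro ⟨x, y⟩ hz
  have hz' : Ftilde x₀ ≤ Ftilde x := hz
  rw [hFtilde, hFtilde] at hz'
  exact hz'.trans (hmin x y)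
end

section
/- Let M = u* v*ᵀ ∈ ℝ^{d₁×d₂} with ‖u*‖₂ = ‖v*‖₂ = 1, and for x ∈ ℝ^{d₁}, x ≠ 0, define f(x) = (1/2)‖(x xᵀ/‖x‖₂²) M − M‖_F². Then f(x) ≤ 1/2 for all x ≠ 0, and f(x_s) = 1/2 for every x_s ≠ 0 with x_sᵀ u* = 0; that is, every nonzero vector orthogonal to u* is a global maximizer of the reduced objective f. -/
open scoped BigOperators

/-- **Vectors orthogonal to `u*` are global maximizers of the reduced objective.**
Let `M = u* v*ᵀ` with `‖u*‖₂ = ‖v*‖₂ = 1`, and for `x ≠ 0` let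
`f(x) = (1/2)‖(x xᵀ/‖x‖₂²) M − M‖_F²`.  Then `f(x) ≤ 1/2` for all `x ≠ 0`, and
`f(x_s) = 1/2` for every `x_s ≠ 0` with `x_sᵀ u* = 0`. -/
theorem reduced_rank_one_objective_global_max_at_orthogonal
    {d₁ d₂ : ℕ}
    (u : EuclideanSpace ℝ (Fin d₁)) (v : EuclideanSpace ℝ (Fin d₂))
    (hu : ‖u‖ = 1) (hv : ‖v‖ = 1)
    (M : Matrix (Fin d₁) (Fin d₂) ℝ) (hM : ∀ i j, M i j = u i * v j)
    (f : EuclideanSpace ℝ (Fin d₁) → ℝ)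
    (hf : ∀ x : EuclideanSpace ℝ (Fin d₁), x ≠ 0 →
      f x = (1 / 2) * ∑ i, ∑ j, ((∑ k, (x i * x k / ‖x‖ ^ 2) * M k j) - M i j) ^ 2) :
    (∀ x : EuclideanSpace ℝ (Fin d₁), x ≠ 0 → f x ≤ 1 / 2) ∧
    (∀ xs : EuclideanSpace ℝ (Fin d₁), xs ≠ 0 → (∑ i, xs i * u i) = 0 → f xs = 1 / 2) := by
  have hu2 : ∑ i, u i ^ 2 = 1 := by
    rw [← EuclideanSpace.real_norm_sq_eq, hu]; norm_num
  have hv2 : ∑ i, v i ^ 2 = 1 := by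
    rw [← EuclideanSpace.real_norm_sq_eq, hv]; norm_num
  have key : ∀ x : EuclideanSpace ℝ (Fin d₁), x ≠ 0 →
      f x = (1 / 2) * (1 - (∑ i, x i * u i) ^ 2 / ‖x‖ ^ 2) := by
    intro x hx
    rw [hf x hx]
    have hn : ‖x‖ ^ 2 ≠ 0 := pow_ne_zero 2 (norm_ne_zero_iff.mpr hx)
    have hx2 : ∑ i, x i ^ 2 = ‖x‖ ^ 2 := (EuclideanSpace.real_norm_sq_eq x).symm
    generalize ‖x‖ ^ 2 = n at hn hx2 ⊢
    obtain ⟨s, hs⟩ : ∃ s, s = ∑ i, x i * u i := ⟨_, rfl⟩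
    have h1 : ∀ i j, (∑ k, (x i * x k / n) * M k j) = x i * s / n * v j := by
      intro i j
      rw [hs, Finset.mul_sum, Finset.sum_div, Finset.sum_mul]
      refine Finset.sum_congr rfl fun k _ => ?_
      rw [hM]; ring
    have h2 : ∀ i, ∑ j, ((∑ k, (x i * x k / n) * M k j) - M i j) ^ 2
        = (s / n) ^ 2 * x i ^ 2 - 2 * (s / n) * (x i * u i) + u i ^ 2 := by
      intro i
      calc _ = ∑ j, (x i * s / n - u i) ^ 2 * v j ^ 2 := by
            refine Finset.sum_congr rfl fun j _ => ?_
            rw [h1, hM]; ring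
        _ = _ := by rw [← Finset.mul_sum, hv2]; ring
    simp only [h2]
    rw [Finset.sum_add_distrib, Finset.sum_sub_distrib, ← Finset.mul_sum, ← Finset.mul_sum,
      hu2, hx2, ← hs]
    field_simp
    ring
  refine ⟨fun x hx => ?_, fun x hx h => ?_⟩
  · rw [key x hx]
    have : 0 ≤ (∑ i, x i * u i) ^ 2 / ‖x‖ ^ 2 := by positivity
    linarith
  · rw [key x hx, h]; norm_num
end
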